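/- Let D be a c-uniform proper subdomain of a Banach space E. Then there is a constant c₄ depending only on c such that for all x, y ∈ D, k_D(x,y) ≤ c₄ log(1 + |x−y|/min{d_D(x), d_D(y)}). Conversely, if this inequality holds for some constant c₄, then D is c-uniform with c depending only on c₄. -/

import Mathlib

open Set Metric MeasureTheory

noncomputable section

variable {E : Type*} [NormedAddCommGroup E]

/-- Distance from a point to the boundary (= complement) of `D`. -/
def dB (D : Set E) (z : E) : ℝ := Metric.infDist z Dᶜ

/-- `D` is a proper subdomain of the ambient space. -/
def IsProperDomain (D : Set E) : Prop := IsOpen D ∧ IsConnected D ∧ Dᶜ.Nonempty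

/-- A rectifiable arc inside `D`, parametrized by arclength on `[a,b]`. -/
structure IsArc (D : Set E) (γ : ℝ → E) (a b : ℝ) : Prop where
  le : a ≤ b
  lip : LipschitzOnWith 1 γ (Set.Icc a b)
  unit : ∀ s t, s ∈ Set.Icc a b → t ∈ Set.Icc a b → s ≤ t →
    eVariationOn γ (Set.Icc s t) = ENNReal.ofReal (t - s)
  mem : ∀ t ∈ Set.Icc a b, γ t ∈ D

/-- Quasihyperbolic length of the piece on `[a,b]` of an arclength-parametrized arc. -/
def qhLen (D : Set E) (γ : ℝ → E) (a b : ℝ) : ℝ := ∫ t in a..b, 1 / dB D (γ t)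

/-- The quasihyperbolic distance in `D`: infimum of quasihyperbolic lengths of
arcs joining the two points. -/
def qhDist (D : Set E) (x y : E) : ℝ :=
  sInf { L : ℝ | ∃ T : ℝ, ∃ γ : ℝ → E,
    IsArc D γ 0 T ∧ γ 0 = x ∧ γ T = y ∧ L = qhLen D γ 0 T }

/-- `γ` is a `c`-quasigeodesic in `D` on `[a,b]`. -/
def IsQuasigeodesicOn (D : Set E) (c : ℝ) (γ : ℝ → E) (a b : ℝ) : Prop :=
  IsArc D γ a b ∧ ∀ s t, s ∈ Set.Icc a b → t ∈ Set.Icc a b → s ≤ t →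
    qhLen D γ s t ≤ c * qhDist D (γ s) (γ t)

/-- The coefficient `c_{x,y}^λ = min (1 + λ/(2 k_D(x,y))) (9/8)`. -/
def cLam (D : Set E) (lam : ℝ) (x y : E) : ℝ :=
  min (1 + lam / (2 * qhDist D x y)) (9 / 8)

/-- `γ` is a `λ`-curve in `D` on `[a,b]`: a `c_{x,y}^λ`-quasigeodesic where `x,y`
are its endpoints. -/
def IsLamCurve (D : Set E) (lam : ℝ) (γ : ℝ → E) (a b : ℝ) : Prop :=
  IsQuasigeodesicOn D (cLam D lam (γ a) (γ b)) γ a b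

/-- `γ` is `h`-short in `D`. -/
def IsShort (D : Set E) (h : ℝ) (γ : ℝ → E) (a b : ℝ) : Prop :=
  IsArc D γ a b ∧ ∀ s t, s ∈ Set.Icc a b → t ∈ Set.Icc a b → s ≤ t →
    qhLen D γ s t ≤ qhDist D (γ s) (γ t) + h

/-- The point `w` lies within quasihyperbolic distance `C` of the union of the
two given sides. -/
def WithinOfSides (D : Set E) (C : ℝ) (w : E) (α : ℝ → E) (a b : ℝ)
    (α' : ℝ → E) (a' b' : ℝ) : Prop :=
  ∃ s : ℝ, (s ∈ Set.Icc a b ∧ qhDist D w (α s) ≤ C) ∨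
    (s ∈ Set.Icc a' b' ∧ qhDist D w (α' s) ≤ C)

/-- `(D, k_D)` is a `(C,h)`-Rips space: every side of an `h`-short triangle lies
in the `C`-neighbourhood of the two other sides. -/
def IsRips (D : Set E) (C h : ℝ) : Prop :=
  ∀ (α₁ α₂ α₃ : ℝ → E) (a₁ b₁ a₂ b₂ a₃ b₃ : ℝ),
    IsShort D h α₁ a₁ b₁ → IsShort D h α₂ a₂ b₂ → IsShort D h α₃ a₃ b₃ →
    α₁ b₁ = α₂ a₂ → α₂ b₂ = α₃ a₃ → α₃ b₃ = α₁ a₁ →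
    (∀ t ∈ Set.Icc a₁ b₁, WithinOfSides D C (α₁ t) α₂ a₂ b₂ α₃ a₃ b₃) ∧
    (∀ t ∈ Set.Icc a₂ b₂, WithinOfSides D C (α₂ t) α₃ a₃ b₃ α₁ a₁ b₁) ∧
    (∀ t ∈ Set.Icc a₃ b₃, WithinOfSides D C (α₃ t) α₁ a₁ b₁ α₂ a₂ b₂)

/-- `D` is `δ`-Gromov hyperbolic with respect to the quasihyperbolic metric. -/
def IsGromovHyp (D : Set E) (δ : ℝ) : Prop :=
  ∀ x ∈ D, ∀ y ∈ D, ∀ z ∈ D, ∀ p ∈ D,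
    min ((qhDist D p x + qhDist D p y - qhDist D x y) / 2)
        ((qhDist D p y + qhDist D p z - qhDist D y z) / 2) - δ ≤
      (qhDist D p x + qhDist D p z - qhDist D x z) / 2

/-- `μ` is a thin-triangles constant for triangles of `c₀`-quasigeodesics in `D`. -/
def ThinTriangles (D : Set E) (c₀ μ : ℝ) : Prop :=
  ∀ (γ₁ γ₂ γ₃ : ℝ → E) (a₁ b₁ a₂ b₂ a₃ b₃ : ℝ),
    IsQuasigeodesicOn D c₀ γ₁ a₁ b₁ → IsQuasigeodesicOn D c₀ γ₂ a₂ b₂ →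
    IsQuasigeodesicOn D c₀ γ₃ a₃ b₃ →
    γ₁ b₁ = γ₂ a₂ → γ₂ b₂ = γ₃ a₃ → γ₃ b₃ = γ₁ a₁ →
    ∀ t ∈ Set.Icc a₁ b₁, WithinOfSides D μ (γ₁ t) γ₂ a₂ b₂ γ₃ a₃ b₃

/-- `D` is a `c`-uniform domain. -/
def IsUniform (D : Set E) (c : ℝ) : Prop :=
  ∀ z₁ ∈ D, ∀ z₂ ∈ D, ∃ γ : ℝ → E, ∃ a b : ℝ, IsArc D γ a b ∧ γ a = z₁ ∧ γ b = z₂ ∧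
    (∀ t ∈ Set.Icc a b, min (t - a) (b - t) ≤ c * dB D (γ t)) ∧
    b - a ≤ c * ‖z₁ - z₂‖

/-- `D` is an `a`-John domain. -/
def IsJohn (D : Set E) (a : ℝ) : Prop :=
  ∀ z₁ ∈ D, ∀ z₂ ∈ D, ∃ γ : ℝ → E, ∃ s t : ℝ, IsArc D γ s t ∧ γ s = z₁ ∧ γ t = z₂ ∧
    ∀ u ∈ Set.Icc s t, min (u - s) (t - u) ≤ a * dB D (γ u)

/-- The inner (length) distance in `D`. -/
def innerDist (D : Set E) (x y : E) : ℝ :=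
  sInf { L : ℝ | ∃ γ : ℝ → E, ∃ s t : ℝ, IsArc D γ s t ∧ γ s = x ∧ γ t = y ∧ L = t - s }

/-- `γ` is an inner `b`-uniform curve in `D`. -/
def IsInnerUniformCurve (D : Set E) (b : ℝ) (γ : ℝ → E) (s t : ℝ) : Prop :=
  (∀ u ∈ Set.Icc s t, min (u - s) (t - u) ≤ b * dB D (γ u)) ∧
  t - s ≤ b * innerDist D (γ s) (γ t)

/-- `D` is an inner `b`-uniform domain. -/
def IsInnerUniform (D : Set E) (b : ℝ) : Prop :=
  ∀ z₁ ∈ D, ∀ z₂ ∈ D, ∃ γ : ℝ → E, ∃ s t : ℝ,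
    IsArc D γ s t ∧ γ s = z₁ ∧ γ t = z₂ ∧ IsInnerUniformCurve D b γ s t

/-- Length (total variation) of a curve on `[a,b]`. -/
def lenOn {F : Type*} [NormedAddCommGroup F] (γ : ℝ → F) (a b : ℝ) : ℝ :=
  (eVariationOn γ (Set.Icc a b)).toReal

variable {F : Type*} [NormedAddCommGroup F]

/-- `f` is a homeomorphism from `D` onto `D'`. -/
def IsHomeoOn (f : E → F) (D : Set E) (D' : Set F) : Prop :=
  ∃ g : F → E, ContinuousOn f D ∧ ContinuousOn g D' ∧ Set.MapsTo f D D' ∧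
    Set.MapsTo g D' D ∧ (∀ x ∈ D, g (f x) = x) ∧ (∀ y ∈ D', f (g y) = y)

/-- `f : D → D'` is `(M,C)`-coarsely quasihyperbolic. -/
def IsCQH (f : E → F) (D : Set E) (D' : Set F) (M C : ℝ) : Prop :=
  ∀ x ∈ D, ∀ y ∈ D,
    (qhDist D x y - C) / M ≤ qhDist D' (f x) (f y) ∧
    qhDist D' (f x) (f y) ≤ M * qhDist D x y + C

theorem hasUnitSpeedOn_Icc_iff {γ : ℝ → E} {a b : ℝ} :
    HasUnitSpeedOn γ (Icc a b) ↔ ∀ s t, s ∈ Icc a b → t ∈ Icc a b → s ≤ t →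
      eVariationOn γ (Icc s t) = ENNReal.ofReal (t - s) := by
  have key : ∀ s t, s ∈ Icc a b → t ∈ Icc a b → Icc a b ∩ Icc s t = Icc s t := fun s t hs ht =>
    inter_eq_right.2 (Icc_subset_Icc hs.1 ht.2)
  rw [HasUnitSpeedOn, hasConstantSpeedOnWith_iff_ordered]
  constructor
  · intro h s t hs ht hst
    simpa [key s t hs ht] using h hs ht hst
  · intro h s hs t ht hst
    simpa [key s t hs ht] using h s t hs ht hst

theorem HasUnitSpeedOn.isArc {D : Set E} {γ : ℝ → E} {a b : ℝ} (h : HasUnitSpeedOn γ (Icc a b))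
    (hab : a ≤ b) (hD : ∀ t ∈ Icc a b, γ t ∈ D) : IsArc D γ a b := by
  rw [hasUnitSpeedOn_Icc_iff] at h
  refine ⟨hab, ?_, h, hD⟩
  have key : ∀ s ∈ Icc a b, ∀ t ∈ Icc a b, s ≤ t → edist (γ s) (γ t) ≤ edist s t := by
    intro s hs t ht hst
    calc edist (γ s) (γ t) ≤ eVariationOn γ (Icc s t) :=
          eVariationOn.edist_le _ (left_mem_Icc.2 hst) (right_mem_Icc.2 hst)
      _ = edist s t := by
          rw [h s t hs ht hst, edist_dist, Real.dist_eq, abs_sub_comm,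
            abs_of_nonneg (sub_nonneg.2 hst)]
  intro s hs t ht
  rw [ENNReal.coe_one, one_mul]
  rcases le_total s t with hst | hst
  · exact key s hs t ht hst
  · rw [edist_comm, edist_comm s t]
    exact key t ht s hs hst

namespace IsArc

variable {D : Set E} {γ β : ℝ → E} {a b c : ℝ}

theorem hasUnitSpeedOn (h : IsArc D γ a b) : HasUnitSpeedOn γ (Icc a b) :=
  hasUnitSpeedOn_Icc_iff.2 h.unit

theorem congr (h : IsArc D γ a b) (hγ : EqOn γ β (Icc a b)) : IsArc D β a b := by
  refine HasUnitSpeedOn.isArc (hasUnitSpeedOn_Icc_iff.2 fun s t hs ht hst => ?_) h.le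
    fun t ht => hγ ht ▸ h.mem t ht
  rw [← h.unit s t hs ht hst]
  exact (eVariationOn.congr (hγ.mono (Icc_subset_Icc hs.1 ht.2))).symm

theorem subarc (h : IsArc D γ a b) {s t : ℝ} (hs : a ≤ s) (hst : s ≤ t) (ht : t ≤ b) :
    IsArc D γ s t :=
  ⟨hst, h.lip.mono (Icc_subset_Icc hs ht),
    fun u v hu hv => h.unit u v (Icc_subset_Icc hs ht hu) (Icc_subset_Icc hs ht hv),
    fun u hu => h.mem u (Icc_subset_Icc hs ht hu)⟩

theorem append (h : IsArc D γ a b) (h' : IsArc D γ b c) : IsArc D γ a c := by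
  refine HasUnitSpeedOn.isArc (h.hasUnitSpeedOn.Icc_Icc h'.hasUnitSpeedOn) (h.le.trans h'.le) ?_
  intro t ht
  rcases le_total t b with htb | htb
  · exact h.mem t ⟨ht.1, htb⟩
  · exact h'.mem t ⟨htb, ht.2⟩

theorem translate (h : IsArc D γ a b) (r : ℝ) : IsArc D (fun t => γ (t + r)) (a - r) (b - r) := by
  have hmem : ∀ {t}, t ∈ Icc (a - r) (b - r) → t + r ∈ Icc a b := fun ht =>
    ⟨by linarith [ht.1], by linarith [ht.2]⟩
  refine HasUnitSpeedOn.isArc (hasUnitSpeedOn_Icc_iff.2 fun s t hs ht hst => ?_)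
    (by linarith [h.le]) fun t ht => h.mem _ (hmem ht)
  have := eVariationOn.comp_eq_of_monotoneOn γ (t := Icc s t) (fun t : ℝ => t + r)
    (fun x _ y _ hxy => by simpa using hxy)
  rw [image_add_const_Icc, h.unit _ _ (hmem hs) (hmem ht) (by linarith)] at this
  rw [show t - s = t + r - (s + r) by ring, ← this]
  rfl

theorem of_dist_eq (hab : a ≤ b) (hD : ∀ t ∈ Icc a b, γ t ∈ D)
    (hγ : ∀ s ∈ Icc a b, ∀ t ∈ Icc a b, dist (γ s) (γ t) = |s - t|) : IsArc D γ a b := by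
  refine HasUnitSpeedOn.isArc (hasUnitSpeedOn_Icc_iff.2 fun s t hs ht hst => le_antisymm ?_ ?_)
    hab hD
  · have hsub := Icc_subset_Icc hs.1 ht.2
    have hlip : LipschitzOnWith 1 γ (Icc s t) := LipschitzOnWith.of_dist_le_mul fun u hu v hv => by
      simp [hγ u (hsub hu) v (hsub hv), Real.dist_eq]
    have h1 := hlip.comp_eVariationOn_le (g := id) (mapsTo_id _)
    have h2 := (MonotoneOn.eVariationOn_eq (f := (id : ℝ → ℝ)) (s := Icc s t)
      (monotone_id.monotoneOn _) (left_mem_Icc.2 hst) (right_mem_Icc.2 hst)).le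
    rw [inter_self] at h2
    simpa using h1.trans (mul_le_mul_right h2 _)
  · have := eVariationOn.edist_le γ (left_mem_Icc.2 hst) (right_mem_Icc.2 hst)
    rwa [edist_dist, hγ s hs t ht, abs_sub_comm, abs_of_nonneg (sub_nonneg.2 hst)] at this

end IsArc

/-- There is an arc in `D` from `x` to `y` of quasihyperbolic length `L`. -/
def JoinedWithLength (D : Set E) (x y : E) (L : ℝ) : Prop :=
  ∃ T : ℝ, ∃ γ : ℝ → E, IsArc D γ 0 T ∧ γ 0 = x ∧ γ T = y ∧ L = qhLen D γ 0 T

section Boundary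

variable {D : Set E}

theorem dB_nonneg (z : E) : 0 ≤ dB D z := infDist_nonneg

theorem dB_le_add_norm (x y : E) : dB D x ≤ dB D y + ‖x - y‖ := by
  rw [← dist_eq_norm]
  exact infDist_le_infDist_add_dist

theorem dB_pos (hD : IsOpen D) (hne : Dᶜ.Nonempty) {z : E} (hz : z ∈ D) : 0 < dB D z :=
  (hD.isClosed_compl.notMem_iff_infDist_pos hne).1 fun h => h hz

theorem mem_of_norm_sub_lt_dB {x y : E} (h : ‖x - y‖ < dB D x) : y ∈ D := by
  by_contra hy
  have : dB D x ≤ dist x y := infDist_le_dist_of_mem hy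
  rw [dist_eq_norm] at this
  linarith

theorem dist_dB_le (x y : E) : dist (dB D x) (dB D y) ≤ dist x y := by
  rw [Real.dist_eq, dist_eq_norm, abs_le]
  have h1 := dB_le_add_norm (D := D) x y
  have h2 := dB_le_add_norm (D := D) y x
  rw [norm_sub_rev] at h2
  constructor <;> linarith

/-- Along an arc, the distance to the boundary extends to a positive `1`-Lipschitz function. -/
theorem IsArc.exists_lipschitz_dB (hD : IsOpen D) (hne : Dᶜ.Nonempty) {γ : ℝ → E} {a b : ℝ}
    (h : IsArc D γ a b) : ∃ d : ℝ → ℝ, LipschitzWith 1 d ∧ (∀ t, 0 < d t) ∧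
      ∀ t ∈ Icc a b, d t = dB D (γ t) := by
  refine ⟨fun t => dB D (γ (projIcc a b h.le t)), ?_,
    fun t => dB_pos hD hne (h.mem _ (projIcc a b h.le t).2), ?_⟩
  · refine LipschitzWith.of_dist_le_mul fun s t => ?_
    calc _ ≤ dist (γ (projIcc a b h.le s)) (γ (projIcc a b h.le t)) := dist_dB_le _ _
      _ ≤ (1 : NNReal) * dist (projIcc a b h.le s : ℝ) (projIcc a b h.le t : ℝ) :=
        h.lip.dist_le_mul _ (projIcc a b h.le s).2 _ (projIcc a b h.le t).2
      _ ≤ _ := by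
        gcongr
        have hproj := (LipschitzWith.projIcc h.le).dist_le_mul s t
        rwa [NNReal.coe_one, one_mul] at hproj
  · intro t ht
    simp [projIcc_of_mem h.le ht]

theorem qhLen_eq_integral {γ : ℝ → E} {a b s t : ℝ} {d : ℝ → ℝ}
    (hd : ∀ t ∈ Icc a b, d t = dB D (γ t)) (hs : a ≤ s) (hst : s ≤ t) (ht : t ≤ b) :
    qhLen D γ s t = ∫ u in s..t, 1 / d u := by
  refine intervalIntegral.integral_congr fun u hu => ?_
  rw [uIcc_of_le hst] at hu
  simp only [hd u ⟨hs.trans hu.1, hu.2.trans ht⟩]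

theorem qhLen_nonneg {γ : ℝ → E} {a b : ℝ} (hab : a ≤ b) : 0 ≤ qhLen D γ a b :=
  intervalIntegral.integral_nonneg hab fun _ _ => one_div_nonneg.2 (dB_nonneg _)

theorem intervalIntegrable_one_div {d : ℝ → ℝ} (hd : LipschitzWith 1 d) (hpos : ∀ t, 0 < d t)
    (s t : ℝ) : IntervalIntegrable (fun u => 1 / d u) volume s t :=
  (continuous_const.div hd.continuous fun u => (hpos u).ne').intervalIntegrable _ _

theorem IsArc.qhLen_add (hD : IsOpen D) (hne : Dᶜ.Nonempty) {γ : ℝ → E} {a b s : ℝ}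
    (h : IsArc D γ a b) (hs : s ∈ Icc a b) :
    qhLen D γ a s + qhLen D γ s b = qhLen D γ a b := by
  obtain ⟨d, hlip, hpos, hd⟩ := h.exists_lipschitz_dB hD hne
  rw [qhLen_eq_integral hd le_rfl hs.1 hs.2, qhLen_eq_integral hd hs.1 hs.2 le_rfl,
    qhLen_eq_integral hd le_rfl h.le le_rfl]
  exact intervalIntegral.integral_add_adjacent_intervals (intervalIntegrable_one_div hlip hpos _ _)
    (intervalIntegrable_one_div hlip hpos _ _)

theorem qhLen_translate (γ : ℝ → E) (a b r : ℝ) :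
    qhLen D (fun t => γ (t + r)) (a - r) (b - r) = qhLen D γ a b := by
  simp only [qhLen]
  rw [intervalIntegral.integral_comp_add_right (fun u => 1 / dB D (γ u))]
  simp

theorem qhLen_congr {γ β : ℝ → E} {a b : ℝ} (hab : a ≤ b) (h : EqOn γ β (Icc a b)) :
    qhLen D γ a b = qhLen D β a b := by
  refine intervalIntegral.integral_congr fun u hu => ?_
  rw [uIcc_of_le hab] at hu
  simp only [h hu]

theorem IsArc.joinedWithLength {γ : ℝ → E} {a b : ℝ} (h : IsArc D γ a b) :
    JoinedWithLength D (γ a) (γ b) (qhLen D γ a b) := by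
  refine ⟨b - a, fun t => γ (t + a), ?_, by simp, by simp, ?_⟩
  · simpa using h.translate a
  · simpa using (qhLen_translate γ a b a).symm

theorem JoinedWithLength.trans (hD : IsOpen D) (hne : Dᶜ.Nonempty) {x y z : E} {K L : ℝ}
    (h : JoinedWithLength D x y K) (h' : JoinedWithLength D y z L) :
    JoinedWithLength D x z (K + L) := by
  obtain ⟨S, γ, hγ, rfl, rfl, rfl⟩ := h
  obtain ⟨T, β, hβ, h0, rfl, rfl⟩ := h'
  set δ : ℝ → E := fun t => if t ≤ S then γ t else β (t - S) with hδ
  have e1 : EqOn γ δ (Icc 0 S) := fun t ht => by simp [hδ, ht.2]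
  have e2 : EqOn (fun t => β (t + -S)) δ (Icc S (S + T)) := fun t ht => by
    rcases ht.1.eq_or_lt with rfl | hlt
    · simp [hδ, h0]
    · simp [hδ, hlt.not_ge, sub_eq_add_neg]
  have a1 : IsArc D δ 0 S := hγ.congr e1
  have a2 : IsArc D δ S (S + T) :=
    IsArc.congr (by simpa [add_comm] using hβ.translate (-S)) e2
  have a3 := a1.append a2
  have hST : S ≤ S + T := a2.le
  refine ⟨S + T, δ, a3, (e1 ⟨le_rfl, hγ.le⟩).symm, ?_, ?_⟩
  · rw [← e2 ⟨hST, le_rfl⟩]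
    simp
  · rw [← a3.qhLen_add hD hne ⟨hγ.le, hST⟩, qhLen_congr hγ.le e1, ← qhLen_congr hST e2]
    congr 1
    simpa [add_comm] using (qhLen_translate β 0 T (-S)).symm

theorem qhDist_le_of_joined {x y : E} {L : ℝ} (h : JoinedWithLength D x y L) :
    qhDist D x y ≤ L :=
  csInf_le ⟨0, by rintro _ ⟨T, γ, hγ, -, -, rfl⟩; exact qhLen_nonneg hγ.le⟩ h

variable [NormedSpace ℝ E]

/-- The arclength parametrization of a line segment. -/
theorem exists_isArc_segment {x y : E} (h : ‖x - y‖ < dB D x) :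
    ∃ γ : ℝ → E, IsArc D γ 0 ‖x - y‖ ∧ γ 0 = x ∧ γ ‖x - y‖ = y ∧
      ∀ t ∈ Icc 0 ‖x - y‖, ‖x - γ t‖ = t := by
  set r := ‖x - y‖ with hr
  set γ : ℝ → E := fun t => x + (t / r) • (y - x) with hγ
  have hr0 : 0 ≤ r := norm_nonneg _
  have hdist : ∀ s ∈ Icc 0 r, ∀ t ∈ Icc 0 r, dist (γ s) (γ t) = |s - t| := by
    intro s hs t ht
    rcases hr0.eq_or_lt with h0 | h0
    · obtain rfl : s = 0 := by linarith [hs.1, hs.2]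
      obtain rfl : t = 0 := by linarith [ht.1, ht.2]
      simp
    · rw [dist_eq_norm, hγ]
      simp only [add_sub_add_left_eq_sub, ← sub_smul, norm_smul, norm_sub_rev y x, ← hr,
        Real.norm_eq_abs, ← sub_div, abs_div, abs_of_pos h0]
      field_simp
  have hγ0 : γ 0 = x := by simp [hγ]
  have hγr : γ r = y := by
    rcases hr0.eq_or_lt with h0 | h0
    · rw [← h0, hγ0]
      exact sub_eq_zero.1 (norm_eq_zero.1 (by rw [← hr, ← h0]))
    · simp [hγ, div_self h0.ne']
  have hnorm : ∀ t ∈ Icc 0 r, ‖x - γ t‖ = t := by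
    intro t ht
    rw [← hγ0, ← dist_eq_norm, hdist 0 ⟨le_rfl, hr0⟩ t ht, zero_sub, abs_neg, abs_of_nonneg ht.1]
  refine ⟨γ, IsArc.of_dist_eq hr0 (fun t ht => ?_) hdist, hγ0, hγr, hnorm⟩
  refine mem_of_norm_sub_lt_dB (x := x) ?_
  rw [hnorm t ht]
  exact ht.2.trans_lt h

theorem exists_joinedWithLength (hD : IsProperDomain D) {x y : E} (hx : x ∈ D) (hy : y ∈ D) :
    ∃ L, JoinedWithLength D x y L := by
  obtain ⟨ho, hc, hne⟩ := hD
  have seg : ∀ {u v : E}, ‖u - v‖ < dB D u → ∃ L, JoinedWithLength D u v L := by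
    intro u v h
    obtain ⟨γ, hγ, h0, h1, -⟩ := exists_isArc_segment h
    have := hγ.joinedWithLength
    rw [h0, h1] at this
    exact ⟨_, this⟩
  have half : ∀ {u v : E}, v ∈ ball u (dB D u / 2) → ‖u - v‖ < dB D u ∧ ‖v - u‖ < dB D v := by
    intro u v h
    rw [mem_ball, dist_eq_norm] at h
    have h1 := dB_le_add_norm (D := D) u v
    rw [norm_sub_rev u v] at h1 ⊢
    constructor <;> linarith [norm_nonneg (v - u)]
  have hmem : ∀ {u : E}, u ∈ D → ball u (dB D u / 2) ⊆ D := fun _ v hv =>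
    mem_of_norm_sub_lt_dB (half hv).1
  let S : Set E := {z | z ∈ D ∧ ∃ L, JoinedWithLength D x z L}
  let S' : Set E := {z | z ∈ D ∧ ¬ ∃ L, JoinedWithLength D x z L}
  have hS : IsOpen S := isOpen_iff.2 fun z hz => by
    obtain ⟨hzD, K, hK⟩ := hz
    refine ⟨_, half_pos (dB_pos ho hne hzD), fun w hw => ⟨hmem hzD hw, ?_⟩⟩
    obtain ⟨L, hL⟩ := seg (half hw).1
    exact ⟨_, hK.trans ho hne hL⟩
  have hS' : IsOpen S' := isOpen_iff.2 fun z hz => by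
    obtain ⟨hzD, hz⟩ := hz
    refine ⟨_, half_pos (dB_pos ho hne hzD), fun w hw => ⟨hmem hzD hw, ?_⟩⟩
    rintro ⟨K, hK⟩
    obtain ⟨L, hL⟩ := seg (half hw).2
    exact hz ⟨_, hK.trans ho hne hL⟩
  by_contra hxy
  obtain ⟨z, -, hz, hz'⟩ := hc.isPreconnected S S' hS hS'
    (fun z hz => (em (∃ L, JoinedWithLength D x z L)).imp (fun h => ⟨hz, h⟩) fun h => ⟨hz, h⟩)
    ⟨x, hx, hx, seg (by simpa using dB_pos ho hne hx)⟩ ⟨y, hy, hy, hxy⟩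
  exact hz'.2 hz.2

/-- Any two points are joined by an arc all of whose subarcs are short. -/
theorem exists_isShort (hD : IsProperDomain D) {x y : E} (hx : x ∈ D) (hy : y ∈ D) {h : ℝ}
    (hh : 0 < h) : ∃ T, ∃ γ : ℝ → E, IsShort D h γ 0 T ∧ γ 0 = x ∧ γ T = y := by
  obtain ⟨_, ⟨T, γ, hγ, rfl, rfl, rfl⟩, hL⟩ := Real.lt_sInf_add_pos
    (s := {L | JoinedWithLength D x y L}) (exists_joinedWithLength hD hx hy) hh
  refine ⟨T, γ, ⟨hγ, fun s t hs ht hst => ?_⟩, rfl, rfl⟩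
  have hst' := (hγ.subarc hs.1 hst ht.2).joinedWithLength
  rw [← sub_le_iff_le_add]
  refine le_csInf ⟨_, hst'⟩ fun L hL' => ?_
  have h1 := (hγ.subarc le_rfl hs.1 hs.2).joinedWithLength
  have h2 := (hγ.subarc ht.1 ht.2 le_rfl).joinedWithLength
  have h3 := qhDist_le_of_joined ((h1.trans hD.1 hD.2.2 hL').trans hD.1 hD.2.2 h2)
  have h4 := hγ.qhLen_add hD.1 hD.2.2 hs
  have h5 := (hγ.subarc hs.1 hs.2 le_rfl).qhLen_add hD.1 hD.2.2 ⟨hst, ht.2⟩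
  change qhLen D γ 0 T < qhDist D (γ 0) (γ T) + h at hL
  linarith

end Boundary

section GrowthEstimates

theorem integral_one_div_add_sub_left {m s t : ℝ} (hm : 0 < m) (hst : s ≤ t) :
    ∫ u in s..t, 1 / (m + (u - s)) = Real.log (1 + (t - s) / m) := by
  have h := intervalIntegral.integral_comp_sub_right (a := s) (b := t) (fun v : ℝ => 1 / v) (s - m)
  rw [show s - (s - m) = m by ring, integral_one_div_of_pos hm (by linarith)] at h
  rw [show 1 + (t - s) / m = (t - (s - m)) / m by field_simp; ring, ← h]
  exact intervalIntegral.integral_congr fun u _ => by ring_nf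

theorem integral_one_div_add_sub_right {m s t : ℝ} (hm : 0 < m) (hst : s ≤ t) :
    ∫ u in s..t, 1 / (m + (t - u)) = Real.log (1 + (t - s) / m) := by
  have h := intervalIntegral.integral_comp_sub_left (a := s) (b := t) (fun v : ℝ => 1 / v) (t + m)
  rw [show t + m - t = m by ring, integral_one_div_of_pos hm (by linarith)] at h
  rw [show 1 + (t - s) / m = (t + m - s) / m by field_simp; ring, ← h]
  exact intervalIntegral.integral_congr fun u _ => by ring_nf

/-- A bound for the solutions `u` of `u ≤ A * log (1 + K * u) + 1`. -/
def logBound (A K : ℝ) : ℝ := 2 * (A + A * Real.log (1 + 2 * A * K) + 1)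

theorem logBound_pos {A K : ℝ} (hA : 0 < A) (hK : 0 < K) : 0 < logBound A K := by
  have hAK : 0 < A * K := mul_pos hA hK
  have := Real.log_nonneg (show 1 ≤ 1 + 2 * A * K by nlinarith)
  unfold logBound
  positivity

theorem le_logBound {A K u : ℝ} (hA : 0 < A) (hK : 0 < K) (hu : 0 ≤ u)
    (h : u ≤ A * Real.log (1 + K * u) + 1) : u ≤ logBound A K := by
  have hAK : 0 < A * K := mul_pos hA hK
  have hKu : 0 ≤ K * u := mul_nonneg hK.le hu
  set N := 1 + 2 * A * K with hN
  have hN1 : 1 ≤ N := by nlinarith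
  have hN0 : 0 < N := by linarith
  have h1 : Real.log (1 + K * u) ≤ Real.log N + ((1 + K * u) / N - 1) := by
    rw [← sub_le_iff_le_add', ← Real.log_div (by linarith) hN0.ne']
    exact Real.log_le_sub_one_of_pos (by positivity)
  have h2 : A * ((1 + K * u) / N) ≤ A + u / 2 := by
    rw [← mul_div_assoc, div_le_iff₀ hN0]
    have : A ≤ A * N := by nlinarith
    nlinarith
  have h3 := mul_le_mul_of_nonneg_left h1 hA.le
  unfold logBound
  rw [← hN]
  nlinarith

theorem exists_first_hit {f : ℝ → ℝ} (hf : Continuous f) {a b M : ℝ} (hab : a ≤ b) (ha : f a ≤ M)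
    (hb : M ≤ f b) : ∃ u ∈ Icc a b, f u = M ∧ ∀ τ ∈ Icc a u, f τ ≤ M := by
  obtain ⟨v, hv, hvM⟩ := intermediate_value_Icc hab hf.continuousOn ⟨ha, hb⟩
  obtain ⟨u, hu⟩ := (isCompact_Icc.inter_right (isClosed_eq hf continuous_const)
    : IsCompact (Icc a b ∩ {x | f x = M})).exists_isLeast ⟨v, hv, hvM⟩
  refine ⟨u, hu.1.1, hu.1.2, fun τ hτ => ?_⟩
  by_contra! hM
  obtain ⟨w, hw, hwM⟩ := intermediate_value_Icc hτ.1 hf.continuousOn ⟨ha, hM.le⟩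
  have h1 : u ≤ w := hu.2 ⟨⟨hw.1, hw.2.trans (hτ.2.trans hu.1.1.2)⟩, hwM⟩
  have h2 : τ = w := le_antisymm (hτ.2.trans h1) hw.2
  rw [h2, hwM] at hM
  exact lt_irrefl _ hM

/-- A model for the distance to the boundary along a `1`-short arc of length `T` in a domain
where the quasihyperbolic distance is bounded logarithmically. -/
structure IsLogShort (d : ℝ → ℝ) (A T : ℝ) : Prop where
  lip : LipschitzWith 1 d
  pos : ∀ t, 0 < d t
  coeff_pos : 0 < A
  integral_le : ∀ s t, 0 ≤ s → s ≤ t → t ≤ T →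
    ∫ u in s..t, 1 / d u ≤ A * Real.log (1 + (t - s) / min (d s) (d t)) + 1

theorem log_one_add_div_le_integral {d : ℝ → ℝ} (hd : LipschitzWith 1 d) (hpos : ∀ t, 0 < d t)
    {s t : ℝ} (hst : s ≤ t) : Real.log (1 + (t - s) / d s) ≤ ∫ u in s..t, 1 / d u := by
  rw [← integral_one_div_add_sub_left (hpos s) hst]
  refine intervalIntegral.integral_mono_on hst ?_ (intervalIntegrable_one_div hd hpos s t) ?_
  · refine ContinuousOn.intervalIntegrable_of_Icc hst
      (continuousOn_const.div (by fun_prop) fun u hu => ?_)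
    have := hpos s
    linarith [hu.1]
  · intro u hu
    have h := hd.dist_le_mul u s
    rw [NNReal.coe_one, one_mul, Real.dist_eq, Real.dist_eq, abs_of_nonneg (sub_nonneg.2 hu.1)] at h
    exact one_div_le_one_div_of_le (hpos u) (by linarith [le_abs_self (d u - d s)])

/-- The length of an interval grows at most exponentially in the integral of `1 / d`. -/
theorem sub_le_mul_exp_integral {d : ℝ → ℝ} (hd : LipschitzWith 1 d) (hpos : ∀ t, 0 < d t)
    {s t B : ℝ} (hst : s ≤ t) (hB : ∫ u in s..t, 1 / d u ≤ B) :
    d s + (t - s) ≤ d s * Real.exp B := by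
  have hs := hpos s
  have h0 : 0 ≤ (t - s) / d s := div_nonneg (sub_nonneg.2 hst) hs.le
  have h := (Real.log_le_iff_le_exp (by linarith)).1
    ((log_one_add_div_le_integral hd hpos hst).trans hB)
  calc d s + (t - s) = d s * (1 + (t - s) / d s) := by field_simp
    _ ≤ _ := mul_le_mul_of_nonneg_left h hs.le

namespace IsLogShort

variable {d : ℝ → ℝ} {A T : ℝ}

theorem reverse (h : IsLogShort d A T) : IsLogShort (fun t => d (T - t)) A T where
  lip := LipschitzWith.of_dist_le_mul fun s t => by
    have := h.lip.dist_le_mul (T - s) (T - t)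
    rwa [dist_sub_left] at this
  pos t := h.pos _
  coeff_pos := h.coeff_pos
  integral_le s t hs hst ht := by
    have := h.integral_le (T - t) (T - s) (by linarith) (by linarith) (by linarith)
    rw [intervalIntegral.integral_comp_sub_left (fun u => 1 / d u), min_comm]
    convert this using 5
    ring

theorem sub_le (h : IsLogShort d A T) {s t K m : ℝ} (hK : 0 < K) (hm : 0 < m) (hs : 0 ≤ s)
    (hst : s ≤ t) (ht : t ≤ T) (hms : m ≤ d s) (hmt : m ≤ d t)
    (hd : ∀ u ∈ Icc s t, d u ≤ K * m) : t - s ≤ logBound A K * (K * m) := by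
  have hKm := mul_pos hK hm
  have h1 : (t - s) / (K * m) ≤ ∫ u in s..t, 1 / d u := by
    have := intervalIntegral.integral_mono_on hst (intervalIntegrable_const (c := 1 / (K * m)))
      (intervalIntegrable_one_div h.lip h.pos s t)
      fun u hu => one_div_le_one_div_of_le (h.pos u) (hd u hu)
    rwa [intervalIntegral.integral_const, smul_eq_mul, mul_one_div] at this
  have h2 : Real.log (1 + (t - s) / min (d s) (d t)) ≤ Real.log (1 + K * ((t - s) / (K * m))) := by
    have e : K * ((t - s) / (K * m)) = (t - s) / m := by field_simp
    rw [e]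
    have := sub_nonneg.2 hst
    have hmin := le_min hms hmt
    have hmin' : 0 < min (d s) (d t) := hm.trans_le hmin
    gcongr
  rw [← div_le_iff₀ hKm]
  refine le_logBound h.coeff_pos hK (div_nonneg (sub_nonneg.2 hst) hKm.le) ?_
  have := mul_le_mul_of_nonneg_left h2 h.coeff_pos.le
  linarith [h.integral_le s t hs hst ht]

theorem le_of_record (h : IsLogShort d A T) (n : ℕ) : ∀ t, 0 ≤ t → t ≤ T →
    (∀ τ ∈ Icc 0 t, d τ ≤ d t) → d t ≤ 2 ^ n * d 0 → t ≤ 2 * logBound A 2 * d t := by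
  have hC := logBound_pos h.coeff_pos two_pos
  have short : ∀ σ t, 0 ≤ σ → σ ≤ t → t ≤ T → d t / 2 ≤ d σ → (∀ τ ∈ Icc 0 t, d τ ≤ d t) →
      t - σ ≤ logBound A 2 * d t := by
    intro σ t h0 hσ ht hdσ hrec
    have hdt := h.pos t
    have := h.sub_le two_pos (half_pos hdt) h0 hσ ht hdσ (by linarith)
      fun u hu => (hrec u ⟨h0.trans hu.1, hu.2⟩).trans (by linarith)
    rwa [mul_div_cancel₀ _ two_ne_zero] at this
  have base : ∀ t, 0 ≤ t → t ≤ T → d t / 2 ≤ d 0 → (∀ τ ∈ Icc 0 t, d τ ≤ d t) →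
      t ≤ 2 * logBound A 2 * d t := by
    intro t ht0 ht hd0 hrec
    have := short 0 t le_rfl ht0 ht hd0 hrec
    nlinarith [mul_pos hC (h.pos t)]
  induction n with
  | zero =>
    intro t ht0 ht hrec hn
    exact base t ht0 ht (by linarith [h.pos t]) hrec
  | succ n ih =>
    intro t ht0 ht hrec hn
    rcases le_total (d t / 2) (d 0) with hd0 | hd0
    · exact base t ht0 ht hd0 hrec
    obtain ⟨σ, hσ, hdσ, hrecσ⟩ := exists_first_hit h.lip.continuous ht0 hd0
      (half_le_self (h.pos t).le)
    have h1 := ih σ hσ.1 (hσ.2.trans ht) (fun τ hτ => hdσ ▸ hrecσ τ hτ)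
      (by rw [hdσ]; rw [pow_succ] at hn; linarith)
    have h2 := short σ t hσ.1 hσ.2 ht hdσ.ge hrec
    rw [hdσ] at h1
    linarith

end IsLogShort

/-- The constant in the double cone condition. -/
def coneBound (A : ℝ) : ℝ :=
  2 * logBound A 2 * Real.exp (A * Real.log (1 + logBound A 1) + 1)

theorem coneBound_pos {A : ℝ} (hA : 0 < A) : 0 < coneBound A := by
  have := logBound_pos hA two_pos
  unfold coneBound
  positivity

namespace IsLogShort

variable {d : ℝ → ℝ} {A T : ℝ}

theorem le_coneBound_of_le (h : IsLogShort d A T) {t t₀ : ℝ} (ht : 0 ≤ t) (htt : t ≤ t₀)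
    (ht₀ : t₀ ≤ T) (hmax : ∀ τ ∈ Icc 0 t₀, d τ ≤ d t₀) : t ≤ coneBound A * d t := by
  obtain ⟨s, hs, hsmax⟩ := (isCompact_Icc (a := 0) (b := t)).exists_isMaxOn
    (nonempty_Icc.2 ht) h.lip.continuous.continuousOn
  have hsmax' : ∀ τ ∈ Icc 0 t, d τ ≤ d s := fun τ hτ => hsmax hτ
  obtain ⟨u, hu, hdu, hule⟩ := exists_first_hit h.lip.continuous htt
    (hsmax' t ⟨ht, le_rfl⟩) (hmax s ⟨hs.1, hs.2.trans htt⟩)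
  have hrec : ∀ τ ∈ Icc 0 u, d τ ≤ d s := fun τ hτ =>
    (le_total τ t).elim (fun hτt => hsmax' τ ⟨hτ.1, hτt⟩) fun hτt => hule τ ⟨hτt, hτ.2⟩
  have hsu : s ≤ u := hs.2.trans hu.1
  have huT : u ≤ T := hu.2.trans ht₀
  have hu0 : 0 ≤ u := ht.trans hu.1
  have hds := h.pos s
  have hlen := h.sub_le one_pos hds hs.1 hsu huT le_rfl hdu.ge
    fun τ hτ => by rw [one_mul]; exact hrec τ ⟨hs.1.trans hτ.1, hτ.2⟩
  rw [one_mul] at hlen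
  have hint : ∫ τ in t..u, 1 / d τ ≤ A * Real.log (1 + logBound A 1) + 1 := by
    have h1 := h.integral_le s u hs.1 hsu huT
    rw [hdu, min_self] at h1
    have h2 : Real.log (1 + (u - s) / d s) ≤ Real.log (1 + logBound A 1) := by
      refine Real.log_le_log ?_ (add_le_add_right ((div_le_iff₀ hds).2 hlen) 1)
      have := div_nonneg (sub_nonneg.2 hsu) hds.le
      linarith
    have h3 := mul_le_mul_of_nonneg_left h2 h.coeff_pos.le
    have h4 := intervalIntegral.integral_add_adjacent_intervals
      (intervalIntegrable_one_div h.lip h.pos s t) (intervalIntegrable_one_div h.lip h.pos t u)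
    have h5 : 0 ≤ ∫ τ in s..t, 1 / d τ :=
      intervalIntegral.integral_nonneg hs.2 fun τ _ => (one_div_pos.2 (h.pos τ)).le
    linarith
  have hgrow : d u ≤ d t * Real.exp (A * Real.log (1 + logBound A 1) + 1) := by
    have h1 := sub_le_mul_exp_integral h.lip h.pos hu.1 hint
    have h2 := h.lip.dist_le_mul u t
    rw [NNReal.coe_one, one_mul, Real.dist_eq, Real.dist_eq,
      abs_of_nonneg (sub_nonneg.2 hu.1)] at h2
    linarith [le_abs_self (d u - d t)]
  obtain ⟨n, hn⟩ := pow_unbounded_of_one_lt (d u / d 0) (one_lt_two (α := ℝ))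
  have hfin := h.le_of_record n u hu0 huT (fun τ hτ => hdu ▸ hrec τ hτ)
    ((div_le_iff₀ (h.pos 0)).1 hn.le)
  have hC := logBound_pos h.coeff_pos two_pos
  calc t ≤ u := hu.1
    _ ≤ 2 * logBound A 2 * d u := hfin
    _ ≤ 2 * logBound A 2 * (d t * Real.exp (A * Real.log (1 + logBound A 1) + 1)) := by gcongr
    _ = coneBound A * d t := by unfold coneBound; ring

/-- The double cone condition. -/
theorem min_le_coneBound (h : IsLogShort d A T) {t : ℝ} (ht : t ∈ Icc 0 T) :
    min t (T - t) ≤ coneBound A * d t := by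
  obtain ⟨t₀, ht₀, hmax⟩ := (isCompact_Icc (a := 0) (b := T)).exists_isMaxOn
    ⟨t, ht⟩ h.lip.continuous.continuousOn
  rcases le_total t t₀ with htt | htt
  · exact (min_le_left _ _).trans
      (h.le_coneBound_of_le ht.1 htt ht₀.2 fun τ hτ => hmax ⟨hτ.1, hτ.2.trans ht₀.2⟩)
  · have := h.reverse.le_coneBound_of_le (t := T - t) (t₀ := T - t₀) (by linarith [ht.2])
      (by linarith) (by linarith [ht₀.1]) fun τ hτ => by
        rw [sub_sub_cancel]
        exact hmax ⟨by linarith [hτ.2, ht₀.1], by linarith [hτ.1]⟩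
    rw [sub_sub_cancel] at this
    exact (min_le_right _ _).trans this

end IsLogShort

end GrowthEstimates

section Uniform

variable {D : Set E}

theorem IsUniform.qhDist_le {c : ℝ} (hc : 1 ≤ c) (hD : IsProperDomain D) (h : IsUniform D c)
    {x y : E} (hx : x ∈ D) (hy : y ∈ D) :
    qhDist D x y ≤
      2 * (1 + 2 * c) * c * Real.log (1 + ‖x - y‖ / min (dB D x) (dB D y)) := by
  obtain ⟨γ, a, b, hγ, rfl, rfl, hcone, hlen⟩ := h x hx y hy
  obtain ⟨d, hlip, hpos, hd⟩ := hγ.exists_lipschitz_dB hD.1 hD.2.2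
  have hab := hγ.le
  rw [← hd a ⟨le_rfl, hab⟩, ← hd b ⟨hab, le_rfl⟩]
  set m := min (d a) (d b) with hm
  have hm0 : 0 < m := lt_min (hpos a) (hpos b)
  have hma : m ≤ d a := min_le_left _ _
  have hmb : m ≤ d b := min_le_right _ _
  have hpt : ∀ t ∈ Icc a b,
      1 / d t ≤ (1 + 2 * c) * (1 / (m + (t - a)) + 1 / (m + (b - t))) := by
    intro t ht
    have hta : 0 ≤ t - a := sub_nonneg.2 ht.1
    have hbt : 0 ≤ b - t := sub_nonneg.2 ht.2
    have hdt := hpos t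
    have hct := hcone t ht
    rw [← hd t ht] at hct
    have key : ∀ r p, 0 ≤ r → m ≤ p → p ≤ d t + r → r ≤ c * d t →
        1 / d t ≤ (1 + 2 * c) * (1 / (m + r)) := by
      intro r p hr hmp hp hrc
      rw [mul_one_div, div_le_div_iff₀ hdt (by linarith)]
      nlinarith
    have lipt : ∀ s, d s ≤ d t + |s - t| := by
      intro s
      have := hlip.dist_le_mul s t
      rw [NNReal.coe_one, one_mul, Real.dist_eq, Real.dist_eq] at this
      linarith [le_abs_self (d s - d t)]
    rw [mul_add]
    have p1 : 0 ≤ (1 + 2 * c) * (1 / (m + (t - a))) := by positivity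
    have p2 : 0 ≤ (1 + 2 * c) * (1 / (m + (b - t))) := by positivity
    rcases min_le_iff.1 hct with h1 | h1
    · have ha := lipt a
      rw [abs_sub_comm, abs_of_nonneg hta] at ha
      linarith [key (t - a) (d a) hta hma ha h1]
    · have hb := lipt b
      rw [abs_of_nonneg hbt] at hb
      linarith [key (b - t) (d b) hbt hmb hb h1]
  have i1 : IntervalIntegrable (fun t => 1 / (m + (t - a))) volume a b :=
    ContinuousOn.intervalIntegrable_of_Icc hab
      (continuousOn_const.div (by fun_prop) fun t ht => by linarith [ht.1])
  have i2 : IntervalIntegrable (fun t => 1 / (m + (b - t))) volume a b :=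
    ContinuousOn.intervalIntegrable_of_Icc hab
      (continuousOn_const.div (by fun_prop) fun t ht => by linarith [ht.2])
  have hint : qhLen D γ a b ≤ 2 * (1 + 2 * c) * Real.log (1 + (b - a) / m) := by
    rw [qhLen_eq_integral hd le_rfl hab le_rfl]
    refine (intervalIntegral.integral_mono_on hab (intervalIntegrable_one_div hlip hpos a b)
      ((i1.add i2).const_mul _) hpt).trans_eq ?_
    rw [intervalIntegral.integral_const_mul, intervalIntegral.integral_add i1 i2,
      integral_one_div_add_sub_left hm0 hab, integral_one_div_add_sub_right hm0 hab]
    ring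
  have hlog : Real.log (1 + (b - a) / m) ≤ c * Real.log (1 + ‖γ a - γ b‖ / m) := by
    have hr : 0 ≤ ‖γ a - γ b‖ / m := by positivity
    have hba : 0 ≤ (b - a) / m := div_nonneg (sub_nonneg.2 hab) hm0.le
    rw [← Real.log_rpow (by linarith)]
    refine Real.log_le_log (by linarith) ?_
    refine le_trans ?_ (one_add_mul_self_le_rpow_one_add (by linarith) hc)
    rw [← mul_div_assoc]
    gcongr
  have hc' : 0 ≤ 2 * (1 + 2 * c) := by linarith
  calc qhDist D (γ a) (γ b) ≤ qhLen D γ a b := qhDist_le_of_joined hγ.joinedWithLength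
    _ ≤ _ := hint
    _ ≤ 2 * (1 + 2 * c) * (c * Real.log (1 + ‖γ a - γ b‖ / m)) :=
      mul_le_mul_of_nonneg_left hlog hc'
    _ = _ := by ring

/-- The uniformity constant obtained from a logarithmic bound of the quasihyperbolic distance
with coefficient `A`. -/
def uniformBound (A : ℝ) : ℝ :=
  coneBound A + (2 + 3 * Real.exp (A * Real.log (1 + 3 * coneBound A) + 1))

theorem isUniform_of_qhDist_le [NormedSpace ℝ E] {A : ℝ} (hA : 0 < A) (hD : IsProperDomain D)
    (h : ∀ x ∈ D, ∀ y ∈ D,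
      qhDist D x y ≤ A * Real.log (1 + ‖x - y‖ / min (dB D x) (dB D y))) :
    IsUniform D (uniformBound A) := by
  intro x hx y hy
  have hC := coneBound_pos hA
  have hexp := Real.exp_pos (A * Real.log (1 + 3 * coneBound A) + 1)
  have hr0 : 0 ≤ ‖x - y‖ := norm_nonneg _
  have hUC : coneBound A ≤ uniformBound A := by unfold uniformBound; linarith
  have hU : 2 + 3 * Real.exp (A * Real.log (1 + 3 * coneBound A) + 1) ≤ uniformBound A := by
    unfold uniformBound; linarith
  have hU1 : 1 ≤ uniformBound A := by linarith
  have hdx := dB_pos hD.1 hD.2.2 hx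
  rcases le_or_gt (2 * ‖x - y‖) (dB D x) with hr | hr
  · obtain ⟨γ, hγ, h0, h1, hnorm⟩ := exists_isArc_segment (D := D) (x := x) (y := y) (by linarith)
    refine ⟨γ, 0, ‖x - y‖, hγ, h0, h1, fun t ht => ?_, by nlinarith⟩
    have hdt := dB_le_add_norm (D := D) x (γ t)
    rw [hnorm t ht] at hdt
    have : min (t - 0) (‖x - y‖ - t) ≤ t - 0 := min_le_left _ _
    have hd0 : 0 ≤ dB D (γ t) := dB_nonneg _
    nlinarith [ht.2]
  · obtain ⟨T, γ, ⟨hγ, hshort⟩, rfl, rfl⟩ := exists_isShort hD hx hy one_pos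
    obtain ⟨d, hlip, hpos, hd⟩ := hγ.exists_lipschitz_dB hD.1 hD.2.2
    have hint : ∀ s t, 0 ≤ s → s ≤ t → t ≤ T →
        ∫ u in s..t, 1 / d u ≤ A * Real.log (1 + ‖γ s - γ t‖ / min (d s) (d t)) + 1 := by
      intro s t hs hst ht
      have hs' : s ∈ Icc 0 T := ⟨hs, hst.trans ht⟩
      have ht' : t ∈ Icc 0 T := ⟨hs.trans hst, ht⟩
      rw [← qhLen_eq_integral hd hs hst ht, hd s hs', hd t ht']
      linarith [hshort s t hs' ht' hst, h _ (hγ.mem s hs') _ (hγ.mem t ht')]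
    have hnorm : ∀ s ∈ Icc 0 T, ∀ t ∈ Icc 0 T, ‖γ s - γ t‖ ≤ |s - t| := by
      intro s hs t ht
      simpa [dist_eq_norm] using hγ.lip.dist_le_mul s hs t ht
    have hls : IsLogShort d A T := by
      refine ⟨hlip, hpos, hA, fun s t hs hst ht => (hint s t hs hst ht).trans ?_⟩
      have := hnorm s ⟨hs, hst.trans ht⟩ t ⟨hs.trans hst, ht⟩
      rw [abs_sub_comm, abs_of_nonneg (sub_nonneg.2 hst)] at this
      have hmin := lt_min (hpos s) (hpos t)
      gcongr
    refine ⟨γ, 0, T, hγ, rfl, rfl, fun t ht => ?_, ?_⟩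
    · rw [sub_zero, ← hd t ht]
      exact (hls.min_le_coneBound ht).trans (mul_le_mul_of_nonneg_right hUC (hpos t).le)
    set r := ‖γ 0 - γ T‖ with hr_def
    rw [sub_zero]
    refine le_trans ?_ (mul_le_mul_of_nonneg_right hU hr0)
    have hrexp := mul_nonneg hr0 hexp.le
    rcases le_or_gt T (2 * r) with hT | hT
    · linarith
    have hrpos : 0 < r := by linarith
    have hs : r ∈ Icc 0 T := ⟨hr0, by linarith⟩
    have ht : T - r ∈ Icc 0 T := ⟨by linarith, by linarith⟩
    have h0 : (0 : ℝ) ∈ Icc 0 T := ⟨le_rfl, hγ.le⟩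
    have hTT : T ∈ Icc 0 T := ⟨hγ.le, le_rfl⟩
    have hst : r ≤ T - r := by linarith
    have c1 := hls.min_le_coneBound hs
    have c2 := hls.min_le_coneBound ht
    rw [min_eq_left hst] at c1
    rw [sub_sub_cancel, min_eq_right hst] at c2
    have hm : r / coneBound A ≤ min (d r) (d (T - r)) :=
      le_min ((div_le_iff₀' hC).2 c1) ((div_le_iff₀' hC).2 c2)
    have n1 := hnorm r hs 0 h0
    have n2 := hnorm T hTT (T - r) ht
    rw [sub_zero, abs_of_nonneg hr0] at n1
    rw [sub_sub_cancel, abs_of_nonneg hr0] at n2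
    have n3 : ‖γ r - γ (T - r)‖ ≤ 3 * r := by
      calc ‖γ r - γ (T - r)‖ = ‖(γ r - γ 0) + (γ 0 - γ T) + (γ T - γ (T - r))‖ := by
            congr 1; abel
        _ ≤ ‖γ r - γ 0‖ + ‖γ 0 - γ T‖ + ‖γ T - γ (T - r)‖ := norm_add₃_le
        _ ≤ 3 * r := by linarith
    have hq : ‖γ r - γ (T - r)‖ / min (d r) (d (T - r)) ≤ 3 * coneBound A := by
      calc ‖γ r - γ (T - r)‖ / min (d r) (d (T - r)) ≤ 3 * r / (r / coneBound A) := by gcongr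
        _ = 3 * coneBound A := by field_simp
    have hB : ∫ u in r..(T - r), 1 / d u ≤ A * Real.log (1 + 3 * coneBound A) + 1 := by
      refine (hint r (T - r) hr0 hst ht.2).trans ?_
      have := lt_min (hpos r) (hpos (T - r))
      gcongr
    have hgrow := sub_le_mul_exp_integral hlip hpos hst hB
    have hdr : d r ≤ 3 * r := by
      have := dB_le_add_norm (D := D) (γ r) (γ 0)
      rw [← hd r hs] at this
      linarith
    have := mul_le_mul_of_nonneg_right hdr hexp.le
    linarith [hpos r]

end Uniform

/-- A domain is `c`-uniform iff the quasihyperbolic metric is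
bounded by `c₄ log (1 + |x-y| / min (d_D x) (d_D y))`, with `c` and `c₄`
depending only on each other. -/
theorem stmt11 :
    (∀ c : ℝ, 1 ≤ c → ∃ c₄ : ℝ, 0 < c₄ ∧
      ∀ (E : Type) [NormedAddCommGroup E] [NormedSpace ℝ E] [CompleteSpace E],
        ∀ D : Set E, IsProperDomain D → IsUniform D c →
          ∀ x ∈ D, ∀ y ∈ D,
            qhDist D x y ≤ c₄ * Real.log (1 + ‖x - y‖ / min (dB D x) (dB D y))) ∧
    (∀ c₄ : ℝ, 0 < c₄ → ∃ c : ℝ, 1 ≤ c ∧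
      ∀ (E : Type) [NormedAddCommGroup E] [NormedSpace ℝ E] [CompleteSpace E],
        ∀ D : Set E, IsProperDomain D →
          (∀ x ∈ D, ∀ y ∈ D,
            qhDist D x y ≤ c₄ * Real.log (1 + ‖x - y‖ / min (dB D x) (dB D y))) →
          IsUniform D c) := by
  refine ⟨fun c hc => ⟨2 * (1 + 2 * c) * c, by positivity, ?_⟩,
    fun c₄ hc₄ => ⟨max 1 (uniformBound c₄), le_max_left _ _, ?_⟩⟩
  · intro E _ _ _ D hD h x hx y hy
    exact h.qhDist_le hc hD hx hy
  · intro E _ _ _ D hD h z₁ hz₁ z₂ hz₂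
    obtain ⟨γ, a, b, hγ, ha, hb, hcone, hlen⟩ := isUniform_of_qhDist_le hc₄ hD h z₁ hz₁ z₂ hz₂
    have hmax : uniformBound c₄ ≤ max 1 (uniformBound c₄) := le_max_right _ _
    exact ⟨γ, a, b, hγ, ha, hb,
      fun t ht => (hcone t ht).trans (mul_le_mul_of_nonneg_right hmax (dB_nonneg _)),
      hlen.trans (mul_le_mul_of_nonneg_right hmax (norm_nonneg _))⟩

end
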